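/- arXiv:2505.13871 — 9 statements merged into one kernel-verified Lean document; each statement's English description precedes it below -/
import Mathlib

section
/- Let b be an orthonormal basis of ℝ³ indexed by Fin 3. There do not exist two nonzero vectors u, v ∈ ℝ³ with ⟪u, v⟫ = 0 such that both u and v are unbiased with respect to b. In particular, ℝ³ does not contain a pair of mutually unbiased orthonormal bases. -/
open scoped RealInnerProductSpace

/-- A sum of an odd number of reals of common absolute value `t` vanishes only if `t = 0`. -/
theorem eq_zero_of_sum_eq_zero_of_abs_eq {ι : Type*} [Fintype ι] (hι : Odd (Fintype.card ι))
    {f : ι → ℝ} {t : ℝ} (hf : ∀ i, |f i| = t) (hsum : ∑ i, f i = 0) : t = 0 := by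
  have hsign : ∀ i, ∃ e : ℤ, Odd e ∧ f i = e * t := fun i ↦ by
    rcases abs_choice (f i) with h | h
    · exact ⟨1, odd_one, by rw [← hf i, h]; simp⟩
    · exact ⟨-1, odd_one.neg, by rw [← hf i, h]; simp⟩
  choose e he hfe using hsign
  have hodd : Odd (∑ i, e i) := by
    have hcast : ((∑ i, e i : ℤ) : ZMod 2) = 1 := by
      rw [Int.cast_sum, Finset.sum_congr rfl fun i _ ↦ ZMod.intCast_eq_one_iff_odd.mpr (he i)]
      simpa using ZMod.natCast_eq_one_iff_odd.mpr hι
    exact ZMod.intCast_eq_one_iff_odd.mp hcast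
  have hmul : ((∑ i, e i : ℤ) : ℝ) * t = 0 := by
    rw [← hsum, Int.cast_sum, Finset.sum_mul]
    exact Finset.sum_congr rfl fun i _ ↦ (hfe i).symm
  refine (mul_eq_zero.mp hmul).resolve_left fun h ↦ ?_
  rw [Int.cast_eq_zero.mp h] at hodd
  exact Int.not_odd_zero hodd

/-- A vector unbiased with respect to an orthonormal basis and orthogonal to one of its vectors
is zero. -/
theorem OrthonormalBasis.eq_zero_of_abs_inner_eq {ι E : Type*} [Fintype ι]
    [NormedAddCommGroup E] [InnerProductSpace ℝ E] (b : OrthonormalBasis ι ℝ E) {u : E}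
    (hu : ∀ i j, |⟪b i, u⟫| = |⟪b j, u⟫|) {i : ι} (hi : ⟪b i, u⟫ = 0) : u = 0 := by
  refine InnerProductSpace.ext_inner_left_basis (𝕜 := ℝ) b.toBasis fun j ↦ ?_
  have hj : |⟪b j, u⟫| = 0 := by rw [hu j i, hi, abs_zero]
  simpa using hj

/-- In odd dimension, two orthogonal vectors that are unbiased with respect to the same
orthonormal basis cannot both be nonzero. -/
theorem OrthonormalBasis.eq_zero_or_eq_zero_of_abs_inner_eq {ι E : Type*} [Fintype ι]
    [NormedAddCommGroup E] [InnerProductSpace ℝ E] (hι : Odd (Fintype.card ι))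
    (b : OrthonormalBasis ι ℝ E) {u v : E} (huv : ⟪u, v⟫ = 0)
    (hu : ∀ i j, |⟪b i, u⟫| = |⟪b j, u⟫|) (hv : ∀ i j, |⟪b i, v⟫| = |⟪b j, v⟫|) :
    u = 0 ∨ v = 0 := by
  obtain ⟨i₀⟩ : Nonempty ι := Fintype.card_pos_iff.mp hι.pos
  have hprod : |⟪b i₀, u⟫| * |⟪b i₀, v⟫| = 0 := by
    refine eq_zero_of_sum_eq_zero_of_abs_eq hι (f := fun i ↦ ⟪u, b i⟫ * ⟪b i, v⟫)
      (fun i ↦ ?_) (by rw [b.sum_inner_mul_inner, huv])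
    rw [abs_mul, real_inner_comm, hu i i₀, hv i i₀]
  rcases mul_eq_zero.mp hprod with h | h
  · exact .inl (b.eq_zero_of_abs_inner_eq hu (abs_eq_zero.mp h))
  · exact .inr (b.eq_zero_of_abs_inner_eq hv (abs_eq_zero.mp h))

theorem no_orthogonal_pair_unbiased_real
    (b : OrthonormalBasis (Fin 3) ℝ (EuclideanSpace ℝ (Fin 3))) :
    (¬ ∃ u v : EuclideanSpace ℝ (Fin 3), u ≠ 0 ∧ v ≠ 0 ∧ ⟪u, v⟫ = 0 ∧
        (∀ i j : Fin 3, |⟪b i, u⟫| = |⟪b j, u⟫|) ∧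
        (∀ i j : Fin 3, |⟪b i, v⟫| = |⟪b j, v⟫|)) ∧
    (¬ ∃ c d : OrthonormalBasis (Fin 3) ℝ (EuclideanSpace ℝ (Fin 3)),
        ∀ i j k l : Fin 3, |⟪c i, d j⟫| = |⟪c k, d l⟫|) := by
  have hodd : Odd (Fintype.card (Fin 3)) := by decide
  constructor
  · rintro ⟨u, v, hu, hv, huv, hbu, hbv⟩
    exact (b.eq_zero_or_eq_zero_of_abs_inner_eq hodd huv hbu hbv).elim hu hv
  · rintro ⟨c, d, h⟩
    have h01 : ⟪d 0, d 1⟫ = 0 := d.orthonormal.inner_eq_zero (by decide)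
    exact (c.eq_zero_or_eq_zero_of_abs_inner_eq hodd h01 (fun i j ↦ h i 0 j 0)
      (fun i j ↦ h i 1 j 1)).elim (d.orthonormal.ne_zero 0) (d.orthonormal.ne_zero 1)
end

section
/- There exists a finite simple graph H (on some Fin n) such that H admits a graph embedding into the orthogonality graph of ℂ³ but admits no graph embedding into the orthogonality graph of ℝ³. That is: there exist n and H : SimpleGraph (Fin n) such that (i) there is an injective map f from Fin n to the 1-dimensional ℂ-subspaces of ℂ³ with the property that H.Adj i j implies f i ≤ (f j)ᗮ, and (ii) there is no injective map g from Fin n to the 1-dimensional ℝ-subspaces of ℝ³ with the property that H.Adj i j implies g i ≤ (g j)ᗮ. -/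
open Module

/-- The family of lines spanned by finitely many nonzero vectors is realised by its own orthogonality
graph: the graph embeds tautologically, and orthogonal vectors give adjacent vertices. -/
theorem exists_graph_of_nonzero_family {m : ℕ} (v : Fin m → EuclideanSpace ℂ (Fin 3))
    (hv : ∀ i, v i ≠ 0) :
    ∃ (n : ℕ) (H : SimpleGraph (Fin n))
      (f : Fin n → {W : Submodule ℂ (EuclideanSpace ℂ (Fin 3)) // finrank ℂ W = 1})
      (σ : Fin m → Fin n), Function.Injective f ∧
      (∀ i j, H.Adj i j → (f i : Submodule ℂ (EuclideanSpace ℂ (Fin 3))) ≤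
        (f j : Submodule ℂ (EuclideanSpace ℂ (Fin 3)))ᗮ) ∧
      (∀ i j, inner ℂ (v i) (v j) = 0 → H.Adj (σ i) (σ j)) ∧
      (∀ i j, σ i = σ j → ∃ c : ℂ, v i = c • v j) := by
  let F : Fin m → {W : Submodule ℂ (EuclideanSpace ℂ (Fin 3)) // finrank ℂ W = 1} :=
    fun i => ⟨ℂ ∙ v i, finrank_span_singleton (hv i)⟩
  obtain ⟨n, ⟨e⟩⟩ := Finite.exists_equiv_fin (Set.range F)
  have hF (i : Fin m) : (e.symm (e ⟨F i, i, rfl⟩) : {W : Submodule ℂ _ // _}) = F i := by simp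
  refine ⟨n, SimpleGraph.fromRel fun i j =>
      (e.symm i).1.1 ⟂ (e.symm j).1.1,
    fun i => e.symm i, fun i => e ⟨F i, i, rfl⟩,
    Subtype.val_injective.comp e.symm.injective, ?_, ?_, ?_⟩
  · rintro i j ⟨-, h | h⟩
    exacts [h, h.symm]
  · intro i j hij
    have key : (F i : Submodule ℂ (EuclideanSpace ℂ (Fin 3))) ⟂ F j := by
      simpa [F, Submodule.isOrtho_span] using hij
    refine ⟨fun h => hv i ?_, Or.inl (by simpa only [hF] using key)⟩
    have h' : F i = F j := congrArg Subtype.val (e.injective h)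
    rw [← h', Submodule.isOrtho_self] at key
    simpa [F] using key
  · intro i j h
    have h' : F i = F j := congrArg Subtype.val (e.injective h)
    have hmem : v i ∈ ℂ ∙ v j := by
      rw [← show ℂ ∙ v i = ℂ ∙ v j from congrArg Subtype.val h']
      exact Submodule.mem_span_singleton_self _
    obtain ⟨c, hc⟩ := Submodule.mem_span_singleton.1 hmem
    exact ⟨c, hc.symm⟩

/-- Over `ℝ` the determinant relations of the Möbius–Kantor configuration, in coordinates adapted to
three of its points, have no nondegenerate solution. -/
theorem moebius_kantor_coordinates_false {d₀ d₁ e₀ e₂ f₁ f₂ g₀ g₁ g₂ h₀ h₁ h₂ : ℝ}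
    (hd₀ : d₀ ≠ 0) (hd₁ : d₁ ≠ 0) (he₀ : e₀ ≠ 0) (he₂ : e₂ ≠ 0)
    (hf : ¬(f₁ = 0 ∧ f₂ = 0)) (hg : ¬(g₀ = 0 ∧ g₁ = 0 ∧ g₂ = 0))
    (hh : ¬(h₀ = 0 ∧ h₁ = 0 ∧ h₂ = 0))
    (hdeg : d₁ * e₂ * g₀ = d₀ * e₂ * g₁ + d₁ * e₀ * g₂)
    (hfg : f₁ * g₂ = f₂ * g₁) (hhe : h₀ * e₂ = h₂ * e₀) (hhg : h₀ * g₁ = h₁ * g₀)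
    (hhdf : h₀ * d₁ * f₂ + h₂ * d₀ * f₁ = h₁ * d₀ * f₂) : False := by
  obtain ⟨l, rfl, rfl⟩ : ∃ l, g₁ = l * f₁ ∧ g₂ = l * f₂ := by
    rcases not_and_or.1 hf with h | h
    · exact ⟨g₁ / f₁, by field_simp, by field_simp; linarith⟩
    · exact ⟨g₂ / f₂, by field_simp; linarith, by field_simp⟩
  obtain ⟨m, rfl, rfl⟩ : ∃ m, h₀ = m * e₀ ∧ h₂ = m * e₂ :=
    ⟨h₀ / e₀, by field_simp, by field_simp; linarith⟩
  obtain ⟨X, hX⟩ : ∃ X, X = d₀ * e₂ * f₁ := ⟨_, rfl⟩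
  obtain ⟨Y, hY⟩ : ∃ Y, Y = d₁ * e₀ * f₂ := ⟨_, rfl⟩
  have hl : l ≠ 0 := by
    rintro rfl
    exact hg (by simpa [hd₁, he₂] using hdeg)
  have key₁ : m * (X + Y) = h₁ * d₀ * f₂ := by linear_combination hhdf + m * hX + m * hY
  have key₂ : h₁ * (X + Y) = m * (e₀ * d₁ * e₂ * f₁) := by
    apply mul_left_cancel₀ hl
    linear_combination l * h₁ * (hX + hY) - h₁ * hdeg - d₁ * e₂ * hhg
  have key₃ : m * (X ^ 2 + X * Y + Y ^ 2) = 0 := by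
    have : m * (X * Y) = m * (d₀ * e₂ * f₁ * (d₁ * e₀ * f₂)) := by rw [hX, hY]
    linear_combination (X + Y) * key₁ + d₀ * f₂ * key₂ - this
  have hXY : X = 0 ∧ Y = 0 := by
    rcases mul_eq_zero.1 key₃ with rfl | h
    · have h1 : h₁ ≠ 0 := by simpa using hh
      have h2 : f₂ = 0 := by simpa [h1, hd₀] using key₁
      have h3 : Y = 0 := by rw [hY, h2, mul_zero]
      exact ⟨by simpa [h1, h3] using key₂, h3⟩
    · constructor <;> nlinarith [sq_nonneg (X + Y), sq_nonneg X, sq_nonneg Y]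
  simp only [hX, hY, mul_eq_zero, hd₀, hd₁, he₀, he₂, false_or] at hXY
  exact hf hXY

/-- Three vectors of a three-dimensional space orthogonal to a common nonzero vector have vanishing
determinant in orthonormal coordinates. -/
theorem det_repr_eq_zero_of_inner_eq_zero {E : Type*} [NormedAddCommGroup E]
    [InnerProductSpace ℝ E] (b : OrthonormalBasis (Fin 3) ℝ E) {m x y z : E} (hm : m ≠ 0)
    (hx : inner ℝ x m = 0) (hy : inner ℝ y m = 0) (hz : inner ℝ z m = 0) :
    (Matrix.of ![(b.repr x : Fin 3 → ℝ), b.repr y, b.repr z]).det = 0 := by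
  have hrow (t : E) : (b.repr t : Fin 3 → ℝ) ⬝ᵥ b.repr m = inner ℝ t m := by
    rw [← b.repr.inner_map_map, PiLp.inner_apply]
    simp [dotProduct, mul_comm]
  refine Matrix.exists_mulVec_eq_zero_iff.1 ⟨b.repr m, fun h => hm ?_, ?_⟩
  · exact b.repr.map_eq_zero_iff.1 (PiLp.ext (congrFun h))
  · ext i
    fin_cases i
    exacts [(hrow x).trans hx, (hrow y).trans hy, (hrow z).trans hz]

/-- Normalising a family of three pairwise orthogonal nonzero vectors of a three-dimensional space
gives an orthonormal basis. -/
theorem exists_orthonormalBasis_eq_normalize {E : Type*} [NormedAddCommGroup E]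
    [InnerProductSpace ℝ E] (hE : finrank ℝ E = 3) {w : Fin 3 → E} (hw : ∀ i, w i ≠ 0)
    (hort : Pairwise fun i j => inner ℝ (w i) (w j) = 0) :
    ∃ b : OrthonormalBasis (Fin 3) ℝ E, ∀ i, b i = ‖w i‖⁻¹ • w i := by
  have hon : Orthonormal ℝ fun i => ‖w i‖⁻¹ • w i := by
    refine ⟨fun i => by simp [norm_smul, hw], fun i j hij => ?_⟩
    simp [inner_smul_left, inner_smul_right, hort hij]
  have : FiniteDimensional ℝ E := .of_finrank_pos (by omega)
  exact ⟨OrthonormalBasis.mk hon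
    (hon.linearIndependent.span_eq_top_of_card_eq_finrank (by simp [hE])).ge, by simp⟩

/-- Orthogonality relations between thirteen rays: the points `0, …, 7` of the Möbius–Kantor
configuration, three of which are chosen mutually orthogonal, and the normals `8, …, 12` of five of
its lines. -/
def moebiusKantorPairs : List (Fin 13 × Fin 13) :=
  [(0, 1), (1, 0), (0, 2), (2, 0), (1, 2), (2, 1), (2, 3), (1, 4), (0, 5),
    (3, 8), (4, 8), (6, 8), (0, 9), (5, 9), (6, 9), (1, 10), (7, 10), (4, 10),
    (2, 11), (7, 11), (6, 11), (7, 12), (3, 12), (5, 12)]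

/-- The orthogonality relations `moebiusKantorPairs` cannot be realised nondegenerately in a
three-dimensional real inner product space. -/
theorem real_moebius_kantor_false {E : Type*} [NormedAddCommGroup E] [InnerProductSpace ℝ E]
    (hE : finrank ℝ E = 3) (u : Fin 13 → E) (hu : ∀ i, u i ≠ 0)
    (hort : ∀ p ∈ moebiusKantorPairs, inner ℝ (u p.1) (u p.2) = 0)
    (h₃₀ : ∀ c : ℝ, u 3 ≠ c • u 0) (h₃₁ : ∀ c : ℝ, u 3 ≠ c • u 1)
    (h₄₀ : ∀ c : ℝ, u 4 ≠ c • u 0) (h₄₂ : ∀ c : ℝ, u 4 ≠ c • u 2) : False := by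
  simp only [moebiusKantorPairs, List.forall_mem_cons, List.not_mem_nil, false_imp_iff,
    implies_true, and_true] at hort
  obtain ⟨h01, h10, h02, h20, h12, h21, h23, h14, h05, h38, h48, h68, h09, h59, h69, h1x, h7x,
    h4x, h2y, h7y, h6y, h7z, h3z, h5z⟩ := hort
  obtain ⟨b, hb⟩ := exists_orthonormalBasis_eq_normalize hE (w := ![u 0, u 1, u 2])
    (by intro i; fin_cases i <;> exact hu _)
    (by intro i j hij; fin_cases i <;> fin_cases j <;> first | exact absurd rfl hij | assumption)
  have hb₀ : b 0 = ‖u 0‖⁻¹ • u 0 := hb 0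
  have hb₁ : b 1 = ‖u 1‖⁻¹ • u 1 := hb 1
  have hb₂ : b 2 = ‖u 2‖⁻¹ • u 2 := hb 2
  have hsum (x : E) := b.sum_repr x
  simp only [Fin.sum_univ_three] at hsum
  have hd₂ : b.repr (u 3) 2 = 0 := by
    simp [b.repr_apply_apply, hb₂, inner_smul_left, h23]
  have he₁ : b.repr (u 4) 1 = 0 := by
    simp [b.repr_apply_apply, hb₁, inner_smul_left, h14]
  have hf₀ : b.repr (u 5) 0 = 0 := by
    simp [b.repr_apply_apply, hb₀, inner_smul_left, h05]
  have hd₀ : b.repr (u 3) 0 ≠ 0 := fun h => h₃₁ (b.repr (u 3) 1 * ‖u 1‖⁻¹) <| by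
    rw [mul_smul, ← hb₁]; simpa [h, hd₂] using (hsum (u 3)).symm
  have hd₁ : b.repr (u 3) 1 ≠ 0 := fun h => h₃₀ (b.repr (u 3) 0 * ‖u 0‖⁻¹) <| by
    rw [mul_smul, ← hb₀]; simpa [h, hd₂] using (hsum (u 3)).symm
  have he₀ : b.repr (u 4) 0 ≠ 0 := fun h => h₄₂ (b.repr (u 4) 2 * ‖u 2‖⁻¹) <| by
    rw [mul_smul, ← hb₂]; simpa [h, he₁] using (hsum (u 4)).symm
  have he₂ : b.repr (u 4) 2 ≠ 0 := fun h => h₄₀ (b.repr (u 4) 0 * ‖u 0‖⁻¹) <| by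
    rw [mul_smul, ← hb₀]; simpa [h, he₁] using (hsum (u 4)).symm
  have hne (i : Fin 13) :
      ¬(b.repr (u i) 0 = 0 ∧ b.repr (u i) 1 = 0 ∧ b.repr (u i) 2 = 0) := fun h => hu i <| by
    simpa [h] using (hsum (u i)).symm
  have hdeg := det_repr_eq_zero_of_inner_eq_zero b (hu 8) h38 h48 h68
  have hfg := det_repr_eq_zero_of_inner_eq_zero b (hu 9) (x := b 0)
    (by simp [hb₀, inner_smul_left, h09]) h59 h69
  have hhe := det_repr_eq_zero_of_inner_eq_zero b (hu 10) (x := b 1)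
    (by simp [hb₁, inner_smul_left, h1x]) h7x h4x
  have hhg := det_repr_eq_zero_of_inner_eq_zero b (hu 11) (x := b 2)
    (by simp [hb₂, inner_smul_left, h2y]) h7y h6y
  have hhdf := det_repr_eq_zero_of_inner_eq_zero b (hu 12) h7z h3z h5z
  simp [Matrix.det_fin_three, hd₂, he₁, hf₀] at hdeg hfg hhe hhg hhdf
  refine moebius_kantor_coordinates_false hd₀ hd₁ he₀ he₂ (by simpa [hf₀] using hne 5) (hne 6)
    (hne 7) ?_ ?_ ?_ ?_ ?_ <;> linarith

/-- A realisation of `moebiusKantorPairs` in `ℂ³`, for `ω` a primitive cube root of unity. -/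
def moebiusKantorVectors (ω : ℂ) : Fin 13 → EuclideanSpace ℂ (Fin 3) :=
  ![!₂[1, 0, 0], !₂[0, 1, 0], !₂[0, 0, 1], !₂[1, 1, 0], !₂[1, 0, 1], !₂[0, 1, ω],
    !₂[1 + ω, 1, ω], !₂[1 + ω, 1, 1 + ω],
    !₂[1, -1, -1], !₂[0, 1 + ω, 1], !₂[1, 0, -1], !₂[1, ω, 0], !₂[1, -1, ω]]

theorem moebiusKantorVectors_ne_zero (ω : ℂ) (i : Fin 13) : moebiusKantorVectors ω i ≠ 0 := by
  intro h
  have h₀ := congrArg (fun x : EuclideanSpace ℂ (Fin 3) => x 0) h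
  have h₁ := congrArg (fun x : EuclideanSpace ℂ (Fin 3) => x 1) h
  have h₂ := congrArg (fun x : EuclideanSpace ℂ (Fin 3) => x 2) h
  fin_cases i <;> simp [moebiusKantorVectors] at h₀ h₁ h₂

theorem moebiusKantorVectors_inner {ω : ℂ} (hω : ω ^ 2 + ω + 1 = 0)
    (hconj : (starRingEnd ℂ) ω = -1 - ω) :
    ∀ p ∈ moebiusKantorPairs,
      inner ℂ (moebiusKantorVectors ω p.1) (moebiusKantorVectors ω p.2) = 0 := by
  simp only [moebiusKantorPairs, List.forall_mem_cons, List.not_mem_nil, false_imp_iff,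
    implies_true, and_true]
  refine ⟨?_, ?_, ?_, ?_, ?_, ?_, ?_, ?_, ?_, ?_, ?_, ?_, ?_, ?_, ?_, ?_, ?_, ?_, ?_, ?_, ?_, ?_,
    ?_, ?_⟩ <;>
  simp [moebiusKantorVectors, PiLp.inner_apply, Fin.sum_univ_three, hconj] <;>
  first | done | ring1 | linear_combination hω | linear_combination -hω

theorem exists_cube_root_conj :
    ∃ ω : ℂ, ω ^ 2 + ω + 1 = 0 ∧ (starRingEnd ℂ) ω = -1 - ω := by
  have h3 : √3 * √3 = (3 : ℝ) := Real.mul_self_sqrt (by norm_num)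
  refine ⟨⟨-1 / 2, √3 / 2⟩, ?_, ?_⟩ <;> apply Complex.ext <;> simp [pow_two] <;> linarith

theorem exists_graph_embedding_complex_not_real :
    ∃ (n : ℕ) (H : SimpleGraph (Fin n)),
      (∃ f : Fin n → {W : Submodule ℂ (EuclideanSpace ℂ (Fin 3)) // Module.finrank ℂ W = 1},
        Function.Injective f ∧
        ∀ i j : Fin n, H.Adj i j → (f i : Submodule ℂ (EuclideanSpace ℂ (Fin 3))) ≤ ((f j : Submodule ℂ (EuclideanSpace ℂ (Fin 3))))ᗮ) ∧
      ¬ (∃ g : Fin n → {W : Submodule ℝ (EuclideanSpace ℝ (Fin 3)) // Module.finrank ℝ W = 1},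
        Function.Injective g ∧
        ∀ i j : Fin n, H.Adj i j → (g i : Submodule ℝ (EuclideanSpace ℝ (Fin 3))) ≤ ((g j : Submodule ℝ (EuclideanSpace ℝ (Fin 3))))ᗮ) := by
  obtain ⟨ω, hω, hconj⟩ := exists_cube_root_conj
  obtain ⟨n, H, f, σ, hf, hfH, hσH, hσ⟩ :=
    exists_graph_of_nonzero_family _ (moebiusKantorVectors_ne_zero ω)
  refine ⟨n, H, ⟨f, hf, hfH⟩, ?_⟩
  rintro ⟨g, hg, hgH⟩
  have hline (i : Fin 13) : ∃ x : EuclideanSpace ℝ (Fin 3), x ≠ 0 ∧ (g (σ i)).1 = ℝ ∙ x := by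
    obtain ⟨x, hx, hspan⟩ := finrank_eq_one_iff'.1 (g (σ i)).2
    refine ⟨x, by simpa using hx, le_antisymm (fun w hw => ?_) (by simp)⟩
    obtain ⟨c, hc⟩ := hspan ⟨w, hw⟩
    exact Submodule.mem_span_singleton.2 ⟨c, congrArg Subtype.val hc⟩
  choose u hu hgu using hline
  have hne (i j : Fin 13)
      (hij : ∀ c : ℂ, moebiusKantorVectors ω i ≠ c • moebiusKantorVectors ω j) (c : ℝ) :
      u i ≠ c • u j := by
    intro h
    have hc : c ≠ 0 := by
      rintro rfl
      exact hu i (by simpa using h)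
    obtain ⟨d, hd⟩ := hσ i j (hg (Subtype.ext (by
      rw [hgu, hgu, h, Submodule.span_singleton_smul_eq hc.isUnit])))
    exact hij d hd
  have hindep (i j : Fin 13) (k : Fin 3) (hi : moebiusKantorVectors ω i k ≠ 0)
      (hj : moebiusKantorVectors ω j k = 0) (c : ℝ) : u i ≠ c • u j :=
    hne i j (fun d h => hi (by simp [h, hj])) c
  refine real_moebius_kantor_false (by simp) u hu (fun p hp => ?_)
    (hindep 3 0 1 ?_ ?_) (hindep 3 1 0 ?_ ?_) (hindep 4 0 2 ?_ ?_) (hindep 4 2 0 ?_ ?_)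
  · have h := hgH _ _ (hσH _ _ (moebiusKantorVectors_inner hω hconj p hp))
    rw [hgu, hgu] at h
    exact Submodule.isOrtho_iff_inner_eq.1 h _ (Submodule.mem_span_singleton_self _) _
      (Submodule.mem_span_singleton_self _)
  all_goals simp [moebiusKantorVectors]
end

section
/- Let G be a simple graph on the vertex set Fin n. Then there exists a family u : Fin n → ℝⁿ of vectors that is linearly independent (hence a basis of ℝⁿ), such that for all i, j: G.Adj i j if and only if ⟪u i, u j⟫ = 0, and moreover ⟪u i, u j⟫ ≥ 0 for all i, j. -/
open scoped RealInnerProductSpace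

open scoped MatrixOrder in
open Matrix in
theorem Matrix.PosDef.exists_linearIndependent_gram_eq {V : Type*} [Fintype V] [DecidableEq V]
    {M : Matrix V V ℝ} (hM : M.PosDef) :
    ∃ u : V → EuclideanSpace ℝ V, LinearIndependent ℝ u ∧ gram ℝ u = M := by
  obtain ⟨B, hB⟩ := CStarAlgebra.nonneg_iff_eq_star_mul_self.mp hM.posSemidef.nonneg
  have hgram : gram ℝ (fun i => WithLp.toLp 2 fun k => B k i : V → EuclideanSpace ℝ V) = M := by
    ext i j
    simp [hB, gram_apply, mul_apply, PiLp.inner_apply, mul_comm]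
  exact ⟨_, linearIndependent_of_posDef_gram (hgram ▸ hM), hgram⟩

open Matrix in
/-- The matrix with diagonal entries `|V| + 2` whose off-diagonal entries are those of the
adjacency matrix of the complement of `G` is positive definite. -/
theorem SimpleGraph.posDef_lapMatrix_add_ones_add_diagonal {V : Type*} [Fintype V] [DecidableEq V]
    (G : SimpleGraph V) [DecidableRel G.Adj] :
    (G.lapMatrix ℝ + vecMulVec 1 (star 1) +
      diagonal fun i => (Fintype.card V : ℝ) + 1 - G.degree i).PosDef := by
  refine PosDef.posSemidef_add
    ((G.posSemidef_lapMatrix ℝ).add (posSemidef_vecMulVec_self_star 1)) (PosDef.diagonal fun i => ?_)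
  have h : (G.degree i : ℝ) < Fintype.card V := mod_cast G.degree_lt_card_verts i
  linarith

theorem finite_graph_orthogonal_basis_representation
    (n : ℕ) (G : SimpleGraph (Fin n)) :
    ∃ u : Fin n → EuclideanSpace ℝ (Fin n),
      LinearIndependent ℝ u ∧
      (∀ i j : Fin n, G.Adj i j ↔ ⟪u i, u j⟫ = 0) ∧
      (∀ i j : Fin n, 0 ≤ ⟪u i, u j⟫) := by
  classical
  obtain ⟨u, hu, hgram⟩ := G.posDef_lapMatrix_add_ones_add_diagonal.exists_linearIndependent_gram_eq
  have inner_eq (i j : Fin n) :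
      ⟪u i, u j⟫ = if i = j then (n : ℝ) + 2 else if G.Adj i j then 0 else 1 := by
    rw [← Matrix.gram_apply (𝕜 := ℝ), hgram]
    by_cases hij : i = j
    · subst hij
      simp [SimpleGraph.lapMatrix, SimpleGraph.degMatrix]
      ring
    · by_cases h : G.Adj i j <;>
        simp [SimpleGraph.lapMatrix, SimpleGraph.degMatrix, hij, h]
  refine ⟨u, hu, fun i j => ?_, fun i j => ?_⟩
  · rw [inner_eq]
    by_cases hij : i = j
    · subst hij
      simp only [SimpleGraph.irrefl, if_true, false_iff]
      positivity
    · simp [hij]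
  · rw [inner_eq]
    split_ifs <;> positivity
end

section
/- Let V be a countable type and G a simple graph on V. Then there exists an injective map f : V → ℓ²(ℕ, ℝ) such that f v ≠ 0 for every v and, for all u, v ∈ V, G.Adj u v if and only if ⟪f u, f v⟫ = 0. -/
open scoped RealInnerProductSpace

/-- The geometric sequence `(1 / 2) ^ n` restricted to a set of indices, as a vector of `ℓ²`. -/
noncomputable def geometricOn (s : Set ℕ) : lp (fun _ : ℕ => ℝ) 2 :=
  ⟨s.indicator fun n => (1 / 2 : ℝ) ^ n, by
    have h : Summable fun n : ℕ => ((1 / 4 : ℝ)) ^ n :=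
      summable_geometric_of_lt_one (by norm_num) (by norm_num)
    refine memℓp_gen (h.of_nonneg_of_le (fun n => by positivity) fun n => ?_)
    by_cases hn : n ∈ s
    · simp only [Set.indicator_of_mem hn, ENNReal.toReal_ofNat, Real.rpow_ofNat, norm_pow,
        ← pow_mul, mul_comm n 2]
      rw [pow_mul]
      norm_num
    · simp [hn]⟩

theorem geometricOn_apply (s : Set ℕ) (n : ℕ) :
    geometricOn s n = s.indicator (fun n => (1 / 2 : ℝ) ^ n) n := rfl

theorem geometricOn_apply_nonneg (s : Set ℕ) (n : ℕ) : 0 ≤ geometricOn s n :=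
  Set.indicator_nonneg (fun _ _ => by positivity) n

theorem geometricOn_apply_eq_zero_iff {s : Set ℕ} {n : ℕ} : geometricOn s n = 0 ↔ n ∉ s := by
  simp [geometricOn_apply]

theorem geometricOn_injective : Function.Injective geometricOn := fun s t h => by
  ext n
  rw [← not_iff_not, ← geometricOn_apply_eq_zero_iff, h, geometricOn_apply_eq_zero_iff]

theorem inner_geometricOn_eq_zero_iff {s t : Set ℕ} :
    ⟪geometricOn s, geometricOn t⟫ = 0 ↔ Disjoint s t := by
  have h := lp.hasSum_inner (𝕜 := ℝ) (geometricOn s) (geometricOn t)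
  have hnonneg (n : ℕ) : 0 ≤ ⟪geometricOn s n, geometricOn t n⟫ :=
    mul_nonneg (geometricOn_apply_nonneg t n) (geometricOn_apply_nonneg s n)
  have hzero : ⟪geometricOn s, geometricOn t⟫ = 0 ↔
      ∀ n, ⟪geometricOn s n, geometricOn t n⟫ = 0 := by
    constructor
    · intro h0
      exact congrFun ((hasSum_zero_iff_of_nonneg hnonneg).1 (h0 ▸ h))
    · intro h0
      simpa only [h0, tsum_zero] using h.tsum_eq.symm
  rw [hzero, Set.disjoint_left]
  refine forall_congr' fun n => ?_
  simp only [RCLike.inner_apply, conj_trivial, mul_eq_zero,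
    geometricOn_apply_eq_zero_iff]
  tauto

/-- The non-edges (including loops) of `G` incident to a vertex. -/
def SimpleGraph.nonEdgesAt {V : Type*} (G : SimpleGraph V) (v : V) : Set (Sym2 V) :=
  {e | v ∈ e ∧ e ∉ G.edgeSet}

theorem SimpleGraph.nonEdgesAt_injective {V : Type*} (G : SimpleGraph V) :
    Function.Injective G.nonEdgesAt := fun u v h => by
  have hu : s(u, u) ∈ G.nonEdgesAt u := by simp [nonEdgesAt]
  rw [h] at hu
  simpa [eq_comm] using hu.1

theorem SimpleGraph.disjoint_nonEdgesAt_iff {V : Type*} (G : SimpleGraph V) {u v : V} :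
    Disjoint (G.nonEdgesAt u) (G.nonEdgesAt v) ↔ G.Adj u v := by
  rw [Set.disjoint_left]
  constructor
  · intro h
    by_contra huv
    exact h (a := s(u, v)) ⟨by simp, by simpa using huv⟩ ⟨by simp, by simpa using huv⟩
  · rintro huv e ⟨hu, he⟩ ⟨hv, -⟩
    rw [(Sym2.mem_and_mem_iff huv.ne).1 ⟨hu, hv⟩] at he
    exact he huv

theorem countable_graph_embeds_in_l2
    (V : Type*) [Countable V] (G : SimpleGraph V) :
    ∃ f : V → lp (fun _ : ℕ => ℝ) 2,
      Function.Injective f ∧ (∀ v : V, f v ≠ 0) ∧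
      (∀ u v : V, G.Adj u v ↔ ⟪f u, f v⟫ = 0) := by
  have : Countable (Sym2 V) := Quot.mk_surjective.countable
  obtain ⟨code, hcode⟩ := exists_injective_nat (Sym2 V)
  have hadj (u v : V) : G.Adj u v ↔
      ⟪geometricOn (code '' G.nonEdgesAt u), geometricOn (code '' G.nonEdgesAt v)⟫ = 0 := by
    rw [inner_geometricOn_eq_zero_iff, Set.disjoint_image_iff hcode, G.disjoint_nonEdgesAt_iff]
  refine ⟨fun v => geometricOn (code '' G.nonEdgesAt v),
    geometricOn_injective.comp (hcode.image_injective.comp G.nonEdgesAt_injective),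
    fun v hv => G.irrefl ((hadj v v).2 ?_), hadj⟩
  exact inner_self_eq_zero.2 hv
end

section
/- Let H be a real Hilbert space, I an infinite index type, θ a real number, and u : I → H an injective family of unit vectors such that ⟪u i, u j⟫ = θ for all i ≠ j. Then θ ≥ 0, and there exist a vector v ∈ H and an orthonormal family w : I → H with ⟪v, w i⟫ = 0 for every i, such that u i = v + √(1 − θ) • w i for every i ∈ I. -/
open scoped RealInnerProductSpace

/-- If `⟪u i, u j⟫ = θ + c * δ_ij` for all `i j : ℕ`, the averages of the first terms of `u`
form a Cauchy sequence. -/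
theorem cauchySeq_average_of_equiangular
    {H : Type*} [NormedAddCommGroup H] [InnerProductSpace ℝ H] {θ c : ℝ} (hc : 0 ≤ c)
    {u : ℕ → H} (hu : ∀ i j, ⟪u i, u j⟫ = θ + if i = j then c else 0) :
    CauchySeq fun n : ℕ => ((n : ℝ) + 1)⁻¹ • ∑ k ∈ Finset.range (n + 1), u k := by
  have hsum : ∀ n m : ℕ, n ≤ m →
      ⟪∑ k ∈ Finset.range (n + 1), u k, ∑ k ∈ Finset.range (m + 1), u k⟫ =
        ((n : ℝ) + 1) * ((m + 1) * θ + c) := by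
    intro n m hnm
    have h : ∀ i ∈ Finset.range (n + 1),
        ⟪u i, ∑ k ∈ Finset.range (m + 1), u k⟫ = ((m : ℝ) + 1) * θ + c := by
      intro i hi
      have him : i < m + 1 := by have := Finset.mem_range.1 hi; omega
      simp only [inner_sum, hu, Finset.sum_add_distrib, Finset.sum_const, Finset.card_range,
        nsmul_eq_mul, Finset.sum_ite_eq, Finset.mem_range, him, if_true]
      push_cast
      ring
    rw [sum_inner, Finset.sum_congr rfl h]
    simp [mul_add]
  refine cauchySeq_of_le_tendsto_0' (fun n : ℕ => √(c * (1 / ((n : ℝ) + 1)))) ?_ ?_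
  · intro n m hnm
    rw [dist_eq_norm]
    apply Real.le_sqrt_of_sq_le
    have hn : (0 : ℝ) < n + 1 := by positivity
    have hm : (0 : ℝ) < m + 1 := by positivity
    rw [norm_sub_sq_real, ← real_inner_self_eq_norm_sq, ← real_inner_self_eq_norm_sq]
    simp only [real_inner_smul_left, real_inner_smul_right, hsum n n le_rfl, hsum m m le_rfl,
      hsum n m hnm]
    have h : 0 ≤ c * (1 / ((m : ℝ) + 1)) := by positivity
    calc _ = c * (1 / ((n : ℝ) + 1)) - c * (1 / ((m : ℝ) + 1)) := by field_simp; ring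
      _ ≤ _ := by linarith
  · have := (tendsto_one_div_add_atTop_nhds_zero_nat (𝕜 := ℝ)).const_mul c
    simpa using this.sqrt

/-- An infinite family with `⟪u i, u j⟫ = θ + c * δ_ij` has a center: a vector whose inner product
with itself and with every member of the family is `θ`. -/
theorem exists_center_of_equiangular
    {H : Type*} [NormedAddCommGroup H] [InnerProductSpace ℝ H] [CompleteSpace H]
    {I : Type*} [Infinite I] [DecidableEq I] {θ c : ℝ} (hc : 0 ≤ c)
    {u : I → H} (hu : ∀ i j, ⟪u i, u j⟫ = θ + if i = j then c else 0) :
    ∃ v : H, ⟪v, v⟫ = θ ∧ ∀ i, ⟪v, u i⟫ = θ := by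
  let f : ℕ ↪ I := Infinite.natEmbedding I
  obtain ⟨v, hv⟩ := cauchySeq_tendsto_of_complete
    (cauchySeq_average_of_equiangular hc (u := u ∘ f) (θ := θ) (by simp [hu]))
  have hvu : ∀ i, ⟪v, u i⟫ = θ := by
    intro i
    refine tendsto_nhds_unique (hv.inner tendsto_const_nhds) ?_
    have hzero := (tendsto_one_div_add_atTop_nhds_zero_nat (𝕜 := ℝ)).const_mul c
    rw [mul_zero] at hzero
    have hexp : ∀ n : ℕ,
        ⟪((n : ℝ) + 1)⁻¹ • ∑ k ∈ Finset.range (n + 1), (u ∘ f) k, u i⟫ =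
          θ + ((n : ℝ) + 1)⁻¹ * ∑ k ∈ Finset.range (n + 1), if f k = i then c else 0 := by
      intro n
      have hn : (n : ℝ) + 1 ≠ 0 := by positivity
      simp only [real_inner_smul_left, sum_inner, Function.comp_apply, hu,
        Finset.sum_add_distrib, Finset.sum_const, Finset.card_range, nsmul_eq_mul]
      push_cast
      field_simp
    have hbound : ∀ n : ℕ, ∑ k ∈ Finset.range (n + 1), (if f k = i then c else 0) ≤ c := by
      intro n
      by_cases h : ∃ k, f k = i
      · obtain ⟨k, rfl⟩ := h
        simp only [f.injective.eq_iff, Finset.sum_ite_eq']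
        split_ifs <;> simp [hc]
      · push Not at h
        simp [h, hc]
    simp only [hexp]
    have : Filter.Tendsto (fun n : ℕ => ((n : ℝ) + 1)⁻¹ *
        ∑ k ∈ Finset.range (n + 1), if f k = i then c else 0) Filter.atTop (nhds 0) := by
      refine squeeze_zero (fun n => ?_) (fun n => ?_) hzero
      · exact mul_nonneg (by positivity)
          (Finset.sum_nonneg fun k _ => by split_ifs <;> simp [hc])
      · rw [one_div, mul_comm c]
        exact mul_le_mul_of_nonneg_left (hbound n) (by positivity)
    simpa using this.const_add θ
  refine ⟨v, tendsto_nhds_unique (tendsto_const_nhds.inner hv) ?_, hvu⟩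
  refine tendsto_const_nhds.congr fun n => ?_
  have hn : (n : ℝ) + 1 ≠ 0 := by positivity
  simp only [real_inner_smul_right, inner_sum, Function.comp_apply, hvu, Finset.sum_const,
    Finset.card_range, nsmul_eq_mul]
  push_cast
  field_simp

theorem equiangular_family_decomposition
    (H : Type*) [NormedAddCommGroup H] [InnerProductSpace ℝ H] [CompleteSpace H]
    (I : Type*) [Infinite I] (θ : ℝ)
    (u : I → H) (hinj : Function.Injective u)
    (hunit : ∀ i, ‖u i‖ = 1)
    (hangle : ∀ i j, i ≠ j → ⟪u i, u j⟫ = θ) :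
    0 ≤ θ ∧
    ∃ (v : H) (w : I → H), Orthonormal ℝ w ∧ (∀ i, ⟪v, w i⟫ = 0) ∧
      ∀ i, u i = v + Real.sqrt (1 - θ) • w i := by
  classical
  have hθ : 0 < 1 - θ := by
    obtain ⟨i, j, hij⟩ := exists_pair_ne I
    rw [← hangle i j hij, sub_pos]
    exact (inner_lt_one_iff_real_of_norm_eq_one (hunit i) (hunit j)).2 (hinj.ne hij)
  have hu : ∀ i j, ⟪u i, u j⟫ = θ + if i = j then 1 - θ else 0 := by
    intro i j
    split_ifs with h
    · subst h
      simp [hunit]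
    · simp [hangle i j h]
  obtain ⟨v, hvv, hvu⟩ := exists_center_of_equiangular hθ.le hu
  have hs : √(1 - θ) ≠ 0 := (Real.sqrt_pos.2 hθ).ne'
  refine ⟨hvv ▸ real_inner_self_nonneg, v, fun i => (√(1 - θ))⁻¹ • (u i - v), ?_, ?_, ?_⟩
  · rw [orthonormal_iff_ite]
    intro i j
    simp only [real_inner_smul_left, real_inner_smul_right, inner_sub_left, inner_sub_right,
      hu, hvv, hvu, real_inner_comm v]
    split_ifs
    · field_simp
      rw [Real.sq_sqrt hθ.le]
      ring
    · ring
  · intro i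
    rw [real_inner_smul_right, inner_sub_right, hvv, hvu, sub_self, mul_zero]
  · intro i
    simp [smul_smul, hs]
end

section
/- Every finite simple graph can be strongly embedded into the orthogonality graph of a finite orthomodular lattice, with image consisting of atoms: for every finite type V and simple graph G on V, there exists a finite orthomodular lattice M and an injective map f : V → M such that f v is an atom of M for every v, and for all u, v ∈ V, G.Adj u v if and only if f u ≤ (f v)ᶜ. -/
/-- An orthomodular lattice. The orthomodular law is given in its cancellation form; the usual
form is `OrthomodularLattice.sup_inf_compl_eq`. -/
class OrthomodularLattice (M : Type*) extends Lattice M, BoundedOrder M, Compl M where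
  compl_compl (x : M) : xᶜᶜ = x
  compl_le_compl {x y : M} : x ≤ y → yᶜ ≤ xᶜ
  inf_compl (x : M) : x ⊓ xᶜ = ⊥
  eq_of_le_of_inf_compl_eq_bot {x y : M} : x ≤ y → y ⊓ xᶜ = ⊥ → x = y

namespace OrthomodularLattice

variable {M : Type*} [OrthomodularLattice M]

theorem le_compl_comm {x y : M} (h : x ≤ yᶜ) : y ≤ xᶜ := by
  simpa only [compl_compl] using compl_le_compl h

theorem compl_le_comm {x y : M} (h : xᶜ ≤ y) : yᶜ ≤ x := by
  simpa only [compl_compl] using compl_le_compl h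

theorem compl_sup (x y : M) : (x ⊔ y)ᶜ = xᶜ ⊓ yᶜ :=
  le_antisymm (le_inf (compl_le_compl le_sup_left) (compl_le_compl le_sup_right))
    (le_compl_comm (sup_le (le_compl_comm inf_le_left) (le_compl_comm inf_le_right)))

theorem compl_inf (x y : M) : (x ⊓ y)ᶜ = xᶜ ⊔ yᶜ := by
  rw [← compl_compl (xᶜ ⊔ yᶜ), compl_sup, compl_compl, compl_compl]

theorem compl_bot : (⊥ : M)ᶜ = ⊤ :=
  top_le_iff.1 (le_compl_comm bot_le)

theorem sup_compl (x : M) : x ⊔ xᶜ = ⊤ := by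
  rw [← compl_compl (x ⊔ xᶜ), compl_sup, compl_compl, inf_comm, inf_compl, compl_bot]

theorem sup_inf_compl_eq {x y : M} (h : x ≤ y) : x ⊔ (y ⊓ xᶜ) = y := by
  refine eq_of_le_of_inf_compl_eq_bot (sup_le h inf_le_left) ?_
  rw [compl_sup, ← inf_assoc, inf_compl]

theorem sup_inf_compl_eq_of_le_compl {x s : M} (h : x ≤ sᶜ) : (x ⊔ s) ⊓ sᶜ = x := by
  have := congrArg (·ᶜ) (sup_inf_compl_eq (le_compl_comm h))
  simpa only [compl_sup, compl_inf, compl_compl, inf_comm, sup_comm] using this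

theorem compl_inf_compl_sup {x s : M} (h : x ≤ sᶜ) : xᶜ ⊓ sᶜ ⊔ s = xᶜ := by
  rw [sup_comm, sup_inf_compl_eq (le_compl_comm h)]

theorem eq_bot_of_le_of_le_compl {x y : M} (h : x ≤ y) (h' : x ≤ yᶜ) : x = ⊥ :=
  le_bot_iff.1 ((le_inf h h').trans_eq (inf_compl y))

/-- The pasting of `M` with `[⊥, sᶜ] × {⊥, p, q, ⊤}` along the section `[⊥, sᶜ] ∪ [s, ⊤]` of `M`,
which is identified with `[⊥, sᶜ] × {⊥, ⊤}`. The elements `(x, p)` and `(x, q)` are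
`side true x` and `side false x`. -/
inductive Pasting (s : M) (hs : s ≠ ⊥) : Type _
  | base (x : M) : Pasting s hs
  | side (t : Bool) (x : M) (hx : x ≤ sᶜ) : Pasting s hs

namespace Pasting

variable {s : M} {hs : s ≠ ⊥}

instance [Finite M] : Finite (Pasting s hs) := by
  refine Finite.of_surjective
    (Sum.elim base (fun a ↦ side a.1 a.2.1 a.2.2) : M ⊕ (Bool × {x : M // x ≤ sᶜ}) → _) ?_
  rintro (x | ⟨t, x, hx⟩)
  exacts [⟨.inl x, rfl⟩, ⟨.inr (t, ⟨x, hx⟩), rfl⟩]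

instance : LE (Pasting s hs) where
  le
    | .base x, .base y => x ≤ y
    | .base x, .side _ y _ => x ≤ y
    | .side _ x _, .base y => x ⊔ s ≤ y
    | .side t x _, .side t' y _ => t = t' ∧ x ≤ y

@[simp] theorem base_le_base {x y : M} : (base x : Pasting s hs) ≤ base y ↔ x ≤ y := Iff.rfl

@[simp] theorem base_le_side {x y : M} {t : Bool} {hy : y ≤ sᶜ} :
    (base x : Pasting s hs) ≤ side t y hy ↔ x ≤ y := Iff.rfl

@[simp] theorem side_le_base {x y : M} {t : Bool} {hx : x ≤ sᶜ} :
    (side t x hx : Pasting s hs) ≤ base y ↔ x ⊔ s ≤ y := Iff.rfl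

@[simp] theorem side_le_side {x y : M} {t t' : Bool} {hx : x ≤ sᶜ} {hy : y ≤ sᶜ} :
    (side t x hx : Pasting s hs) ≤ side t' y hy ↔ t = t' ∧ x ≤ y := Iff.rfl

theorem not_sup_le (hs : s ≠ ⊥) {x y : M} (hy : y ≤ sᶜ) : ¬ x ⊔ s ≤ y := fun h ↦
  hs (eq_bot_of_le_of_le_compl le_rfl ((le_sup_right.trans h).trans hy))

instance : PartialOrder (Pasting s hs) where
  le_refl := by rintro (x | ⟨t, x, hx⟩) <;> simp
  le_trans := by
    rintro (x | ⟨t, x, hx⟩) (y | ⟨t', y, hy⟩) (z | ⟨t'', z, hz⟩) <;>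
      simp only [base_le_base, base_le_side, side_le_base, side_le_side]
    · exact le_trans
    · exact le_trans
    · exact fun h h' ↦ h.trans (le_sup_left.trans h')
    · exact fun h h' ↦ h.trans h'.2
    · exact le_trans
    · exact fun h h' ↦ (not_sup_le hs hz (h.trans h')).elim
    · exact fun h h' ↦ (sup_le_sup_right h.2 s).trans h'
    · exact fun h h' ↦ ⟨h.1.trans h'.1, h.2.trans h'.2⟩
  le_antisymm := by
    rintro (x | ⟨t, x, hx⟩) (y | ⟨t', y, hy⟩) <;>
      simp only [base_le_base, base_le_side, side_le_base, side_le_side]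
    · exact fun h h' ↦ congrArg _ (le_antisymm h h')
    · exact fun h h' ↦ (not_sup_le hs hy (h'.trans h)).elim
    · exact fun h h' ↦ (not_sup_le hs hx (h.trans h')).elim
    · rintro ⟨rfl, h⟩ ⟨-, h'⟩
      obtain rfl := le_antisymm h h'
      rfl

instance : BoundedOrder (Pasting s hs) where
  bot := base ⊥
  top := base ⊤
  bot_le := by rintro (x | ⟨t, x, hx⟩) <;> simp
  le_top := by rintro (x | ⟨t, x, hx⟩) <;> simp

theorem bot_def : (⊥ : Pasting s hs) = base ⊥ := rfl

instance : Compl (Pasting s hs) where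
  compl
    | .base x => base xᶜ
    | .side t x _ => side (!t) (xᶜ ⊓ sᶜ) inf_le_right

@[simp] theorem compl_base (x : M) : (base x : Pasting s hs)ᶜ = base xᶜ := rfl

@[simp] theorem compl_side (t : Bool) (x : M) (hx : x ≤ sᶜ) :
    (side t x hx : Pasting s hs)ᶜ = side (!t) (xᶜ ⊓ sᶜ) inf_le_right := rfl

protected theorem compl_compl (a : Pasting s hs) : aᶜᶜ = a := by
  rcases a with x | ⟨t, x, hx⟩
  · simp [OrthomodularLattice.compl_compl]
  · simp [compl_inf, OrthomodularLattice.compl_compl, sup_inf_compl_eq_of_le_compl hx]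

protected theorem compl_le_compl {a b : Pasting s hs} : a ≤ b → bᶜ ≤ aᶜ := by
  rcases a with x | ⟨t, x, hx⟩ <;> rcases b with y | ⟨t', y, hy⟩ <;>
    simp only [base_le_base, base_le_side, side_le_base, side_le_side, compl_base, compl_side]
  · exact OrthomodularLattice.compl_le_compl
  · rw [compl_inf_compl_sup hy]
    exact OrthomodularLattice.compl_le_compl
  · rw [← compl_sup]
    exact OrthomodularLattice.compl_le_compl
  · exact fun h ↦ ⟨by rw [h.1], inf_le_inf_right _ (OrthomodularLattice.compl_le_compl h.2)⟩

open scoped Classical in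
/-- The meet operation of a pasting. -/
noncomputable def meet : Pasting s hs → Pasting s hs → Pasting s hs
  | .base x, .base y => base (x ⊓ y)
  | .base x, .side t y hy => if s ≤ x then side t (x ⊓ y) (inf_le_right.trans hy) else base (x ⊓ y)
  | .side t x hx, .base y => if s ≤ y then side t (x ⊓ y) (inf_le_left.trans hx) else base (x ⊓ y)
  | .side t x hx, .side t' y _ =>
      if t = t' then side t (x ⊓ y) (inf_le_left.trans hx) else base (x ⊓ y)

theorem meet_comm (a b : Pasting s hs) : meet a b = meet b a := by
  rcases a with x | ⟨t, x, hx⟩ <;> rcases b with y | ⟨t', y, hy⟩ <;>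
    simp only [meet, inf_comm]
  by_cases h : t = t'
  · subst h; rfl
  · simp [h, Ne.symm h]

theorem meet_le_left (a b : Pasting s hs) : meet a b ≤ a := by
  rcases a with x | ⟨t, x, hx⟩ <;> rcases b with y | ⟨t', y, hy⟩ <;>
    simp only [meet] <;> (try split_ifs) <;> simp [*]

theorem le_meet {a b c : Pasting s hs} (hb : a ≤ b) (hc : a ≤ c) : a ≤ meet b c := by
  rcases a with x | ⟨t, x, hx⟩ <;> rcases b with y | ⟨t', y, hy⟩ <;>
    rcases c with z | ⟨t'', z, hz⟩ <;>
    simp only [base_le_base, base_le_side, side_le_base, side_le_side] at hb hc <;>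
    simp only [meet] <;> (try split_ifs) <;> simp_all

noncomputable instance : Lattice (Pasting s hs) where
  inf := meet
  inf_le_left := meet_le_left
  inf_le_right a b := (meet_comm a b).trans_le (meet_le_left b a)
  le_inf _ _ _ := le_meet
  sup a b := (meet aᶜ bᶜ)ᶜ
  le_sup_left a b := by
    simpa only [Pasting.compl_compl] using Pasting.compl_le_compl (meet_le_left aᶜ bᶜ)
  le_sup_right a b := by
    rw [meet_comm]
    simpa only [Pasting.compl_compl] using Pasting.compl_le_compl (meet_le_left bᶜ aᶜ)
  sup_le a b c ha hb := by
    simpa only [Pasting.compl_compl] using Pasting.compl_le_compl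
      (le_meet (Pasting.compl_le_compl ha) (Pasting.compl_le_compl hb))

theorem inf_def (a b : Pasting s hs) : a ⊓ b = meet a b := rfl

noncomputable instance : OrthomodularLattice (Pasting s hs) where
  compl_compl := Pasting.compl_compl
  compl_le_compl := Pasting.compl_le_compl
  inf_compl := by
    rintro (x | ⟨t, x, hx⟩)
    · simp [inf_def, meet, bot_def, inf_compl]
    · simp [inf_def, meet, bot_def, ← inf_assoc, inf_compl]
  eq_of_le_of_inf_compl_eq_bot := by
    rintro (x | ⟨t, x, hx⟩) (y | ⟨t', y, hy⟩)
    · simpa [inf_def, meet, bot_def] using eq_of_le_of_inf_compl_eq_bot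
    · intro h
      have : s ≤ xᶜ := le_compl_comm (le_trans (base_le_side.1 h) hy)
      simp [inf_def, meet, bot_def, this]
    · intro h
      have : s ≤ y := le_sup_right.trans (side_le_base.1 h)
      simp [inf_def, meet, bot_def, this]
    · rintro ⟨rfl, h⟩
      have : y ⊓ (xᶜ ⊓ sᶜ) = y ⊓ xᶜ := by
        rw [inf_comm xᶜ, ← inf_assoc, inf_eq_left.2 hy]
      simpa [inf_def, meet, bot_def, this] using eq_of_le_of_inf_compl_eq_bot h

theorem isAtom_base {a : M} (ha : IsAtom a) (hsa : s ≠ a) : IsAtom (base a : Pasting s hs) := by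
  rw [isAtom_iff_le_of_ge]
  refine ⟨fun h ↦ ha.1 (base.inj h), ?_⟩
  rintro (x | ⟨t, x, hx⟩) hne hle
  · exact (isAtom_iff_le_of_ge.1 ha).2 x (fun h ↦ hne (h ▸ rfl)) hle
  · exact absurd ((ha.le_iff_eq hs).1 (le_sup_right.trans (side_le_base.1 hle))) hsa

theorem isAtom_side_bot (t : Bool) : IsAtom (side t ⊥ bot_le : Pasting s hs) := by
  rw [isAtom_iff_le_of_ge]
  refine ⟨nofun, ?_⟩
  rintro (x | ⟨t', x, hx⟩) hne hle
  · exact absurd (congrArg base (le_bot_iff.1 hle)) hne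
  · exact ⟨hle.1.symm, bot_le⟩

end Pasting

/-- Every element can be replaced by an atom with the same orthogonality to the old elements. -/
theorem exists_orthogonal_iff_atoms_on {V : Type*} [DecidableEq V] {adj : V → V → Prop}
    (M₀ : Type) [Finite M₀] [OrthomodularLattice M₀] (f₀ : V → M₀)
    (inj : Function.Injective f₀) (ne : ∀ v, f₀ v ≠ ⊥) (orth : ∀ u v, adj u v ↔ f₀ u ≤ (f₀ v)ᶜ)
    (W : Finset V) :
    ∃ (M : Type) (_ : Finite M) (_ : OrthomodularLattice M) (f : V → M),
      Function.Injective f ∧ (∀ v, f v ≠ ⊥) ∧ (∀ v ∈ W, IsAtom (f v)) ∧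
        ∀ u v, adj u v ↔ f u ≤ (f v)ᶜ := by
  induction W using Finset.induction_on with
  | empty => exact ⟨M₀, ‹_›, ‹_›, f₀, inj, ne, by simp, orth⟩
  | insert v W hv ih =>
    obtain ⟨M, _, _, f, inj, ne, atom, orth⟩ := ih
    by_cases hfv : IsAtom (f v)
    · exact ⟨M, ‹_›, ‹_›, f, inj, ne, by simpa [hfv] using atom, orth⟩
    let p : Pasting (f v) (ne v) := .side true ⊥ bot_le
    refine ⟨Pasting (f v) (ne v), inferInstance, inferInstance,
      fun u ↦ if u = v then p else .base (f u), ?_, ?_, ?_, ?_⟩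
    · intro u w h
      dsimp only at h
      split_ifs at h with hu hw hw
      · exact hu.trans hw.symm
      · exact inj (Pasting.base.inj h)
    · intro u
      dsimp only
      split_ifs with hu
      · exact (Pasting.isAtom_side_bot true).1
      · exact fun h ↦ ne u (Pasting.base.inj h)
    · intro u hu
      dsimp only
      split_ifs with huv
      · exact Pasting.isAtom_side_bot true
      · have := atom u ((Finset.mem_insert.1 hu).resolve_left huv)
        exact Pasting.isAtom_base this fun h ↦ huv (inj h).symm
    · intro u w
      rw [orth]
      dsimp only
      split_ifs with hu hw hw
      · subst hu hw
        simpa [p] using fun h ↦ ne _ (eq_bot_of_le_of_le_compl le_rfl h)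
      · subst hu
        simp [p]
      · subst hw
        simp [p, compl_bot]
      · simp

instance (α : Type*) : OrthomodularLattice (Set α) where
  compl_compl := _root_.compl_compl
  compl_le_compl := _root_.compl_le_compl
  inf_compl _ := inf_compl_eq_bot
  eq_of_le_of_inf_compl_eq_bot h h' :=
    h.antisymm (sdiff_eq_bot_iff.1 (sdiff_eq.trans h'))

end OrthomodularLattice

/-- Send a vertex to the set of non-adjacent ordered pairs containing it. -/
theorem SimpleGraph.exists_set_representation {V : Type*} [Finite V] (G : SimpleGraph V) :
    ∃ (E : Type) (_ : Finite E) (f : V → Set E), Function.Injective f ∧ (∀ v, f v ≠ ⊥) ∧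
      ∀ u v, G.Adj u v ↔ f u ≤ (f v)ᶜ := by
  obtain ⟨n, ⟨e⟩⟩ := Finite.exists_equiv_fin V
  let f (v : V) : Set (Fin n × Fin n) :=
    {x | ¬ G.Adj (e.symm x.1) (e.symm x.2) ∧ (v = e.symm x.1 ∨ v = e.symm x.2)}
  have mem (v : V) : (e v, e v) ∈ f v := by simp [f]
  refine ⟨Fin n × Fin n, inferInstance, f, fun u v h ↦ ?_, fun v h ↦ ?_, fun u v ↦ ?_⟩
  · have := h ▸ mem u
    simpa [f, eq_comm] using this
  · simpa [h] using mem v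
  · constructor
    · rintro huv ⟨x, y⟩ ⟨h, hu⟩ ⟨-, hv⟩
      rcases hu with rfl | rfl <;> rcases hv with rfl | rfl
      · exact huv.ne rfl
      · exact h huv
      · exact h huv.symm
      · exact huv.ne rfl
    · intro h
      by_contra huv
      exact h (show (e u, e v) ∈ f u by simp [f, huv]) (by simp [f, huv])

theorem finite_graph_strongly_embeds_in_finite_OML
    (V : Type*) [Finite V] (G : SimpleGraph V) :
    ∃ (M : Type) (_ : Fintype M) (_ : Lattice M) (_ : BoundedOrder M) (compl : M → M),
      (∀ x : M, compl (compl x) = x) ∧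
      (∀ x y : M, x ≤ y → compl y ≤ compl x) ∧
      (∀ x : M, x ⊓ compl x = ⊥) ∧
      (∀ x : M, x ⊔ compl x = ⊤) ∧
      (∀ x y : M, x ≤ y → y = x ⊔ (y ⊓ compl x)) ∧
      ∃ f : V → M, Function.Injective f ∧ (∀ v : V, IsAtom (f v)) ∧
        (∀ u v : V, G.Adj u v ↔ f u ≤ compl (f v)) := by
  classical
  obtain ⟨E, _, f₀, inj₀, ne₀, orth₀⟩ := G.exists_set_representation
  have := Fintype.ofFinite V
  obtain ⟨M, _, _, f, inj, -, atom, orth⟩ :=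
    OrthomodularLattice.exists_orthogonal_iff_atoms_on (Set E) f₀ inj₀ ne₀ orth₀ Finset.univ
  exact ⟨M, Fintype.ofFinite M, inferInstance, inferInstance, (·ᶜ),
    OrthomodularLattice.compl_compl, fun _ _ ↦ OrthomodularLattice.compl_le_compl,
    OrthomodularLattice.inf_compl, OrthomodularLattice.sup_compl,
    fun _ _ h ↦ (OrthomodularLattice.sup_inf_compl_eq h).symm,
    f, inj, fun v ↦ atom v (Finset.mem_univ v), orth⟩
end

section
/- Let L be a finite orthomodular lattice. Then there exist a finite orthomodular lattice M and an injective map g : L → M such that: (1) for all x, y ∈ L with x ≠ ⊥ and y ≠ ⊥, x ≤ yᶜ if and only if g x ≤ (g y)ᶜ; and (2) for every x ∈ L and every finite subset A ⊆ L, g x ≤ ⨆_{a ∈ A} g a (the join in M of the image of A under g) if and only if x ∈ A. -/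
/-- A lattice structure transported along an equivalence. -/
abbrev Equiv.transportLattice {α β : Type*} [Lattice α] (e : α ≃ β) : Lattice β where
  le x y := e.symm x ≤ e.symm y
  le_refl _ := le_refl _
  le_trans _ _ _ := le_trans
  le_antisymm _ _ hxy hyx := e.symm.injective (le_antisymm hxy hyx)
  sup x y := e (e.symm x ⊔ e.symm y)
  inf x y := e (e.symm x ⊓ e.symm y)
  le_sup_left _ _ := by simp
  le_sup_right _ _ := by simp
  sup_le _ _ _ hxz hyz := by simpa using ⟨hxz, hyz⟩
  inf_le_left _ _ := by simp
  inf_le_right _ _ := by simp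
  le_inf _ _ _ hxy hxz := by simpa using ⟨hxy, hxz⟩

theorem exists_small_lattice_orderIso (α : Type*) [Finite α] [Lattice α] :
    ∃ (β : Type) (_ : Lattice β), Nonempty (α ≃o β) := by
  obtain ⟨n, ⟨e⟩⟩ := Finite.exists_equiv_fin α
  obtain ⟨β, ⟨f⟩⟩ : ∃ β : Type, Nonempty (α ≃ β) := ⟨Fin n, ⟨e⟩⟩
  let := f.transportLattice
  refine ⟨β, inferInstance, ⟨⟨f, ?_⟩⟩⟩
  intro a b
  change f.symm (f a) ≤ f.symm (f b) ↔ a ≤ b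
  simp

theorem le_sup_prod_singleton_iff {L : Type*} [Lattice L] [OrderBot L] (x : L) (A : Finset L) :
    (x, ({x} : Set L)) ≤ A.sup (fun a => (a, ({a} : Set L))) ↔ x ∈ A := by
  refine ⟨fun h => ?_, fun h => Finset.le_sup (f := fun a => (a, ({a} : Set L))) h⟩
  have hle : A.sup (fun a => (a, ({a} : Set L))) ≤ (A.sup id, (A : Set L)) :=
    Finset.sup_le fun a ha => ⟨Finset.le_sup (f := id) ha, by simpa using ha⟩
  simpa using (h.trans hle).2

theorem finite_OML_orthogonality_and_join_separating_extension
    (L : Type*) [Fintype L] [Lattice L] [BoundedOrder L] (complL : L → L)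
    (hL1 : ∀ x : L, complL (complL x) = x)
    (hL2 : ∀ x y : L, x ≤ y → complL y ≤ complL x)
    (hL3 : ∀ x : L, x ⊓ complL x = ⊥)
    (hL4 : ∀ x : L, x ⊔ complL x = ⊤)
    (hL5 : ∀ x y : L, x ≤ y → y = x ⊔ (y ⊓ complL x)) :
    ∃ (M : Type) (_ : Fintype M) (_ : Lattice M) (_ : BoundedOrder M) (complM : M → M),
      (∀ x : M, complM (complM x) = x) ∧
      (∀ x y : M, x ≤ y → complM y ≤ complM x) ∧
      (∀ x : M, x ⊓ complM x = ⊥) ∧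
      (∀ x : M, x ⊔ complM x = ⊤) ∧
      (∀ x y : M, x ≤ y → y = x ⊔ (y ⊓ complM x)) ∧
      ∃ g : L → M, Function.Injective g ∧
        (∀ x y : L, x ≠ ⊥ → y ≠ ⊥ → (x ≤ complL y ↔ g x ≤ complM (g y))) ∧
        (∀ (x : L) (A : Finset L), g x ≤ A.sup g ↔ x ∈ A) := by
  obtain ⟨M, _, ⟨e⟩⟩ := exists_small_lattice_orderIso (L × Set L)
  let : BoundedOrder M :=
    { top := e ⊤
      bot := e ⊥
      le_top := fun x => by rw [← e.symm_apply_le]; exact le_top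
      bot_le := fun x => by rw [← e.le_symm_apply]; exact bot_le }
  have : Finite M := Finite.of_equiv _ e.toEquiv
  let c : L × Set L → L × Set L := fun p => (complL p.1, p.2ᶜ)
  refine ⟨M, Fintype.ofFinite M, inferInstance, inferInstance, fun x => e (c (e.symm x)),
    ?_, ?_, ?_, ?_, ?_, fun x => e (x, {x}), ?_, ?_, ?_⟩
  · intro x
    simp [c, hL1]
  · intro x y hxy
    have h := e.symm.monotone hxy
    exact e.monotone ⟨hL2 _ _ h.1, compl_le_compl h.2⟩
  · intro x
    apply e.symm.injective
    rw [map_inf, map_bot, e.symm_apply_apply]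
    exact Prod.ext (hL3 _) (inf_compl_self _)
  · intro x
    apply e.symm.injective
    rw [map_sup, map_top, e.symm_apply_apply]
    exact Prod.ext (hL4 _) sup_compl_eq_top
  · intro x y hxy
    have h := e.symm.monotone hxy
    apply e.symm.injective
    rw [map_sup, map_inf, e.symm_apply_apply]
    refine Prod.ext (hL5 _ _ h.1) ?_
    change (e.symm y).2 = (e.symm x).2 ⊔ ((e.symm y).2 \ (e.symm x).2)
    exact (sup_sdiff_cancel_right h.2).symm
  · intro x y hxy
    exact congrArg Prod.fst (e.injective hxy)
  · intro x y hx _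
    simp only [e.symm_apply_apply, e.le_iff_le, c, Prod.mk_le_mk]
    refine ⟨fun h => ⟨h, ?_⟩, And.left⟩
    rintro a rfl rfl
    exact hx (by rw [← hL3 a, inf_eq_left.mpr h])
  · intro x A
    have h := map_finset_sup e A (fun a => (a, ({a} : Set L)))
    change e (x, {x}) ≤ A.sup (e ∘ fun a => (a, ({a} : Set L))) ↔ x ∈ A
    rw [← h, e.le_iff_le, le_sup_prod_singleton_iff]
end

section
/- Let L be a finite orthomodular lattice and e ∈ L with e ≠ ⊥. Then there exist a finite orthomodular lattice M, an OML embedding h : L → M, and an atom a of M such that: (1) a ∉ range h and a < h e; (2) for every x ∈ L, a ≤ h x if and only if e ≤ x, and every m ∈ M with h e ≤ m lies in the range of h; and (3) for every atom x of L with x ≠ e, the element h x is an atom of M. -/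
universe u v

/-- The laws of an orthomodular lattice for the complementation `c`. -/
structure IsOrthomodular {L : Type u} [Lattice L] [BoundedOrder L] (c : L → L) : Prop where
  compl_compl : ∀ x, c (c x) = x
  antitone : ∀ x y, x ≤ y → c y ≤ c x
  inf_compl : ∀ x, x ⊓ c x = ⊥
  sup_compl : ∀ x, x ⊔ c x = ⊤
  orthomodular : ∀ x y, x ≤ y → y = x ⊔ (y ⊓ c x)

namespace IsOrthomodular

variable {L : Type u} [Lattice L] [BoundedOrder L] {c : L → L}

theorem le_compl_iff (hc : IsOrthomodular c) {x y : L} : x ≤ c y ↔ y ≤ c x :=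
  ⟨fun h => by simpa [hc.compl_compl] using hc.antitone _ _ h,
   fun h => by simpa [hc.compl_compl] using hc.antitone _ _ h⟩

theorem compl_sup (hc : IsOrthomodular c) (x y : L) : c (x ⊔ y) = c x ⊓ c y :=
  le_antisymm (le_inf (hc.antitone _ _ le_sup_left) (hc.antitone _ _ le_sup_right))
    (hc.le_compl_iff.2 (sup_le (hc.le_compl_iff.2 inf_le_left) (hc.le_compl_iff.2 inf_le_right)))

theorem eq_bot_of_le_of_le_compl (hc : IsOrthomodular c) {x y : L} (h : x ≤ y) (h' : x ≤ c y) :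
    x = ⊥ :=
  le_bot_iff.1 ((le_inf h h').trans (hc.inf_compl y).le)

theorem eq_of_inf_compl_eq_bot (hc : IsOrthomodular c) {x y : L} (h : x ≤ y)
    (h' : y ⊓ c x = ⊥) : x = y := by
  simpa [h'] using (hc.orthomodular x y h).symm

end IsOrthomodular

/-- An antitone involution turns a meet-semilattice into a lattice. -/
abbrev SemilatticeInf.toLatticeOfInvolution {M : Type u} [SemilatticeInf M] (c : M → M)
    (hc : ∀ x, c (c x) = x) (anti : ∀ x y, x ≤ y → c y ≤ c x) : Lattice M where
  sup x y := c (c x ⊓ c y)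
  le_sup_left x y := by simpa [hc] using anti _ _ (inf_le_left : c x ⊓ c y ≤ c x)
  le_sup_right x y := by simpa [hc] using anti _ _ (inf_le_right : c x ⊓ c y ≤ c y)
  sup_le x y z h h' := by simpa [hc] using anti _ _ (le_inf (anti _ _ h) (anti _ _ h'))
  inf := (· ⊓ ·)
  inf_le_left _ _ := inf_le_left
  inf_le_right _ _ := inf_le_right
  le_inf _ _ _ := le_inf

/-- For an orthocomplementation, the orthomodular law follows from its cancellation form. -/
theorem IsOrthomodular.of_cancel {M : Type u} [Lattice M] [BoundedOrder M] {c : M → M}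
    (compl_compl : ∀ x, c (c x) = x) (antitone : ∀ x y, x ≤ y → c y ≤ c x)
    (inf_compl : ∀ x, x ⊓ c x = ⊥)
    (cancel : ∀ x y, x ≤ y → y ⊓ c x = ⊥ → x = y) : IsOrthomodular c where
  compl_compl := compl_compl
  antitone := antitone
  inf_compl := inf_compl
  sup_compl x := by
    refine eq_top_iff.2 ?_
    have h : c (x ⊔ c x) = ⊥ := by
      rw [← le_bot_iff, ← inf_compl x]
      refine le_inf ?_ (antitone _ _ le_sup_left)
      simpa [compl_compl] using antitone _ _ (le_sup_right : c x ≤ x ⊔ c x)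
    simpa [compl_compl] using antitone _ (c ⊤) (h.trans_le bot_le)
  orthomodular x y h := by
    refine (cancel _ _ (sup_le h inf_le_left) (le_bot_iff.1 ?_)).symm
    rw [← inf_compl (y ⊓ c x)]
    exact le_inf (le_inf inf_le_left (inf_le_right.trans (antitone _ _ le_sup_left)))
      (inf_le_right.trans (antitone _ _ le_sup_right))

/-- The elements of Kalmbach's coatom extension of `L` at `e`. In the pasting of `L` with
`([⊥, c e] ∪ [e, ⊤]) × 2` the element `(s, 0)` is identified with `s` when `s ≤ c e`, and `(s, 1)`
with `s` when `e ≤ s`; the remaining elements are `upper s = (s, 1)` for `s ≤ c e` and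
`lower s = (s, 0)` for `e ≤ s`. -/
inductive CoatomExtension {L : Type u} [LE L] (c : L → L) (e : L) : Type u
  | base (x : L)
  | upper (s : L) (hs : s ≤ c e)
  | lower (s : L) (hs : e ≤ s)

namespace CoatomExtension

section Order

variable {L : Type u} [Lattice L] {c : L → L} {e : L}

instance [Finite L] : Finite (CoatomExtension c e) := by
  refine Finite.of_injective (β := L × Fin 3) (fun
    | base x => (x, 0)
    | upper s _ => (s, 1)
    | lower s _ => (s, 2)) ?_
  rintro (_ | _ | _) (_ | _ | _) <;> simp

instance : LE (CoatomExtension c e) where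
  le
    | base x, base y => x ≤ y
    | base x, upper s _ => x ≤ s
    | base x, lower s _ => x ≤ s ∧ x ≤ c e
    | upper s _, base y => s ≤ y ∧ e ≤ y
    | upper s _, upper t _ => s ≤ t
    | upper _ _, lower _ _ => False
    | lower s _, base y => s ≤ y
    | lower _ _, upper _ _ => False
    | lower s _, lower t _ => s ≤ t

@[simp] theorem base_le_base {x y : L} : (base x : CoatomExtension c e) ≤ base y ↔ x ≤ y := Iff.rfl

@[simp] theorem base_le_upper {x s : L} {hs : s ≤ c e} :
    (base x : CoatomExtension c e) ≤ upper s hs ↔ x ≤ s := Iff.rfl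

@[simp] theorem base_le_lower {x s : L} {hs : e ≤ s} :
    (base x : CoatomExtension c e) ≤ lower s hs ↔ x ≤ s ∧ x ≤ c e := Iff.rfl

@[simp] theorem upper_le_base {y s : L} {hs : s ≤ c e} :
    (upper s hs : CoatomExtension c e) ≤ base y ↔ s ≤ y ∧ e ≤ y := Iff.rfl

@[simp] theorem upper_le_upper {s t : L} {hs : s ≤ c e} {ht : t ≤ c e} :
    (upper s hs : CoatomExtension c e) ≤ upper t ht ↔ s ≤ t := Iff.rfl

@[simp] theorem not_upper_le_lower {s t : L} {hs : s ≤ c e} {ht : e ≤ t} :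
    ¬ (upper s hs : CoatomExtension c e) ≤ lower t ht := id

@[simp] theorem lower_le_base {y s : L} {hs : e ≤ s} :
    (lower s hs : CoatomExtension c e) ≤ base y ↔ s ≤ y := Iff.rfl

@[simp] theorem not_lower_le_upper {s t : L} {hs : e ≤ s} {ht : t ≤ c e} :
    ¬ (lower s hs : CoatomExtension c e) ≤ upper t ht := id

@[simp] theorem lower_le_lower {s t : L} {hs : e ≤ s} {ht : e ≤ t} :
    (lower s hs : CoatomExtension c e) ≤ lower t ht ↔ s ≤ t := Iff.rfl

open Classical in
/-- The meet of two elements of the coatom extension. -/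
noncomputable def meet : CoatomExtension c e → CoatomExtension c e → CoatomExtension c e
  | base x, base y => base (x ⊓ y)
  | base x, upper s hs => if e ≤ x then upper (x ⊓ s) (inf_le_right.trans hs) else base (x ⊓ s)
  | upper s hs, base x => if e ≤ x then upper (x ⊓ s) (inf_le_right.trans hs) else base (x ⊓ s)
  | base x, lower s hs => if h : e ≤ x then lower (x ⊓ s) (le_inf h hs) else base (x ⊓ s ⊓ c e)
  | lower s hs, base x => if h : e ≤ x then lower (x ⊓ s) (le_inf h hs) else base (x ⊓ s ⊓ c e)
  | upper s hs, upper t _ => upper (s ⊓ t) (inf_le_left.trans hs)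
  | upper s _, lower t _ => base (s ⊓ t)
  | lower t _, upper s _ => base (s ⊓ t)
  | lower s hs, lower t ht => lower (s ⊓ t) (le_inf hs ht)

/-- The complementation of the coatom extension. -/
def compl (hcc : ∀ x, c (c x) = x) (anti : ∀ x y, x ≤ y → c y ≤ c x) :
    CoatomExtension c e → CoatomExtension c e
  | base x => base (c x)
  | upper s hs => lower (c s) (by simpa [hcc] using anti _ _ hs)
  | lower s hs => upper (c s) (anti _ _ hs)

theorem compl_compl (hcc : ∀ x, c (c x) = x) (anti : ∀ x y, x ≤ y → c y ≤ c x)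
    (m : CoatomExtension c e) : compl hcc anti (compl hcc anti m) = m := by
  cases m <;> simp [compl, hcc]

theorem base_injective : Function.Injective (base : L → CoatomExtension c e) :=
  fun _ _ => base.inj

end Order

variable {L : Type u} [Lattice L] [BoundedOrder L] {c : L → L} {e : L}

/-- The coatom extension is partially ordered if `e ≠ ⊥`. -/
abbrev partialOrder (hc : IsOrthomodular c) (he : e ≠ ⊥) : PartialOrder (CoatomExtension c e) where
  le_refl := by rintro (_ | _ | _) <;> simp
  le_trans := by
    have key : ∀ x, e ≤ x → ¬ x ≤ c e := fun x h h' =>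
      he (hc.eq_bot_of_le_of_le_compl le_rfl (h.trans h'))
    rintro (_ | _ | _) (_ | _ | _) (_ | _ | _) <;> simp <;> grind
  le_antisymm := by
    have key : ∀ x, e ≤ x → ¬ x ≤ c e := fun x h h' =>
      he (hc.eq_bot_of_le_of_le_compl le_rfl (h.trans h'))
    rintro (_ | _ | _) (_ | _ | _) <;> simp <;> grind

/-- The coatom extension is a meet-semilattice if `e ≠ ⊥`. -/
noncomputable abbrev semilatticeInf (hc : IsOrthomodular c) (he : e ≠ ⊥) :
    SemilatticeInf (CoatomExtension c e) where
  toPartialOrder := partialOrder hc he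
  inf := meet
  inf_le_left := by
    have hl : ∀ x y : L, x ⊓ y ≤ x := fun _ _ => inf_le_left
    have hr : ∀ x y : L, x ⊓ y ≤ y := fun _ _ => inf_le_right
    rintro (_ | _ | _) (_ | _ | _) <;> simp only [meet] <;> (try split_ifs) <;> simp <;> grind
  inf_le_right := by
    have hl : ∀ x y : L, x ⊓ y ≤ x := fun _ _ => inf_le_left
    have hr : ∀ x y : L, x ⊓ y ≤ y := fun _ _ => inf_le_right
    rintro (_ | _ | _) (_ | _ | _) <;> simp only [meet] <;> (try split_ifs) <;> simp <;> grind
  le_inf := by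
    rintro (_ | _ | _) (_ | _ | _) (_ | _ | _) <;> simp only [meet] <;> (try split_ifs) <;>
      simp <;> grind

theorem compl_le_compl (hc : IsOrthomodular c) {m n : CoatomExtension c e} (h : m ≤ n) :
    compl hc.compl_compl hc.antitone n ≤ compl hc.compl_compl hc.antitone m := by
  have anti := hc.antitone
  have hle : ∀ x y, x ≤ c y → y ≤ c x := fun _ _ => hc.le_compl_iff.1
  revert h
  rcases m with _ | _ | _ <;> rcases n with _ | _ | _ <;> simp [compl] <;> grind

/-- The coatom extension is a lattice if `e ≠ ⊥`. -/
noncomputable abbrev lattice (hc : IsOrthomodular c) (he : e ≠ ⊥) :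
    Lattice (CoatomExtension c e) :=
  letI := semilatticeInf hc he
  SemilatticeInf.toLatticeOfInvolution (compl hc.compl_compl hc.antitone) (compl_compl _ _)
    fun _ _ => compl_le_compl hc

/-- The coatom extension has `base ⊥` and `base ⊤` as its least and greatest elements. -/
abbrev boundedOrder : BoundedOrder (CoatomExtension c e) where
  bot := base ⊥
  top := base ⊤
  bot_le := by rintro (_ | _ | _) <;> simp
  le_top := by rintro (_ | _ | _) <;> simp

theorem isOrthomodular (hc : IsOrthomodular c) (he : e ≠ ⊥) :
    letI := lattice hc he
    letI := boundedOrder (c := c) (e := e)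
    IsOrthomodular (compl hc.compl_compl hc.antitone : CoatomExtension c e → _) := by
  let := lattice hc he
  let := boundedOrder (c := c) (e := e)
  have hle : ∀ x, x ≤ c e → e ≤ c x := fun _ => hc.le_compl_iff.1
  refine .of_cancel (compl_compl _ _) (fun _ _ => compl_le_compl hc) ?_ ?_
  · intro m
    change meet m _ = base ⊥
    rcases m with _ | _ | _ <;> simp [compl, meet, hc.inf_compl, inf_comm (c _)]
  · intro m n h h'
    change meet n _ = base ⊥ at h'
    revert h h'
    have := fun x y => hc.eq_of_inf_compl_eq_bot (x := x) (y := y)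
    rcases m with _ | _ | _ <;> rcases n with _ | _ | _ <;> simp [compl, meet] <;> grind

theorem base_inf (hc : IsOrthomodular c) (he : e ≠ ⊥) (x y : L) :
    letI := lattice hc he
    (base (x ⊓ y) : CoatomExtension c e) = base x ⊓ base y :=
  rfl

theorem base_sup (hc : IsOrthomodular c) (he : e ≠ ⊥) (x y : L) :
    letI := lattice hc he
    (base (x ⊔ y) : CoatomExtension c e) = base x ⊔ base y := by
  change _ = base (c (c x ⊓ c y))
  rw [← hc.compl_sup, hc.compl_compl]

/-- The new atom of the coatom extension, lying below `base e`. -/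
def atom (c : L → L) (e : L) : CoatomExtension c e := upper ⊥ bot_le

theorem isAtom_atom (hc : IsOrthomodular c) (he : e ≠ ⊥) :
    letI := lattice hc he
    letI := boundedOrder (c := c) (e := e)
    IsAtom (atom c e) := by
  let := lattice hc he
  let := boundedOrder (c := c) (e := e)
  refine ⟨nofun, fun m hm => ?_⟩
  change m = base ⊥
  have hle := hm.le
  have hne := hm.ne
  rcases m with x | s | s <;> simp_all [atom]

theorem atom_notMem_range_base : atom c e ∉ Set.range base := by
  rintro ⟨_, h⟩
  cases h

theorem atom_le_base_iff {x : L} : atom c e ≤ base x ↔ e ≤ x := by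
  simp [atom]

theorem mem_range_base_of_base_le (hc : IsOrthomodular c) (he : e ≠ ⊥)
    {m : CoatomExtension c e} (hm : base e ≤ m) : m ∈ Set.range base := by
  rcases m with x | ⟨s, hs⟩ | s
  · exact ⟨x, rfl⟩
  · exact absurd (hc.eq_bot_of_le_of_le_compl le_rfl (le_trans (base_le_upper.1 hm) hs)) he
  · exact absurd (hc.eq_bot_of_le_of_le_compl le_rfl (base_le_lower.1 hm).2) he

theorem isAtom_base (hc : IsOrthomodular c) (he : e ≠ ⊥) {x : L} (hx : IsAtom x) (hxe : x ≠ e) :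
    letI := lattice hc he
    letI := boundedOrder (c := c) (e := e)
    IsAtom (base x : CoatomExtension c e) := by
  let := lattice hc he
  let := boundedOrder (c := c) (e := e)
  have hex : ¬ e ≤ x := fun h => (hx.le_iff.1 h).elim he (hxe ·.symm)
  refine ⟨fun h => hx.1 (base.inj h), fun m hm => ?_⟩
  have hle := hm.le
  rcases m with y | ⟨s, hs⟩ | ⟨s, hs⟩
  · have hyx : y < x := lt_of_le_of_ne hle fun h => hm.ne (congrArg base h)
    exact congrArg base (hx.2 y hyx)
  · exact absurd (upper_le_base.1 hle).2 hex
  · exact absurd (hs.trans (lower_le_base.1 hle)) hex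

end CoatomExtension

/-- The lattice structure transported along an equivalence. -/
abbrev Equiv.latticeTransport {N : Type v} {M : Type u} [Lattice M] (f : N ≃ M) : Lattice N :=
  letI : Max N := ⟨fun x y => f.symm (f x ⊔ f y)⟩
  letI : Min N := ⟨fun x y => f.symm (f x ⊓ f y)⟩
  letI : LE N := ⟨fun x y => f x ≤ f y⟩
  letI : LT N := ⟨fun x y => f x < f y⟩
  f.injective.lattice f Iff.rfl Iff.rfl (fun _ _ => f.apply_symm_apply _)
    fun _ _ => f.apply_symm_apply _

/-- A finite orthomodular lattice has an isomorphic copy in the lowest universe. -/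
theorem IsOrthomodular.exists_orderIso_type_zero {L : Type u} [Finite L] [Lattice L]
    [BoundedOrder L] {c : L → L} (hc : IsOrthomodular c) :
    ∃ (N : Type) (_ : Finite N) (_ : Lattice N) (_ : BoundedOrder N) (d : N → N) (g : L ≃o N),
      IsOrthomodular d ∧ ∀ x, g (c x) = d (g x) := by
  obtain ⟨N, ⟨f⟩⟩ : ∃ N : Type, Nonempty (L ≃ N) :=
    (Finite.exists_equiv_fin L).imp' Fin fun _ => id
  let _ := f.symm.latticeTransport
  let g : L ≃o N := ⟨f, by
    intro x y
    change f.symm (f x) ≤ f.symm (f y) ↔ _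
    simp⟩
  let _ : BoundedOrder (N) :=
    { bot := g ⊥, bot_le := fun x => g.le_symm_apply.1 bot_le
      top := g ⊤, le_top := fun x => g.symm_apply_le.1 le_top }
  have key : IsOrthomodular fun x => g (c (g.symm x)) := by
    refine ⟨fun x => by simp [hc.compl_compl], fun x y h => ?_, fun x => ?_, fun x => ?_,
      fun x y h => ?_⟩
    · exact g.monotone (hc.antitone _ _ (g.symm.monotone h))
    · apply g.symm.injective
      simp [hc.inf_compl]
    · apply g.symm.injective
      simp [hc.sup_compl]
    · apply g.symm.injective
      simpa using hc.orthomodular _ _ (g.symm.monotone h)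
  exact ⟨N, .of_equiv L f, _, _, _, g, key, fun x => by simp⟩

theorem kalmbach_coatom_extension
    (L : Type*) [Fintype L] [Lattice L] [BoundedOrder L] (complL : L → L)
    (hL1 : ∀ x : L, complL (complL x) = x)
    (hL2 : ∀ x y : L, x ≤ y → complL y ≤ complL x)
    (hL3 : ∀ x : L, x ⊓ complL x = ⊥)
    (hL4 : ∀ x : L, x ⊔ complL x = ⊤)
    (hL5 : ∀ x y : L, x ≤ y → y = x ⊔ (y ⊓ complL x))
    (e : L) (he : e ≠ ⊥) :
    ∃ (M : Type) (_ : Fintype M) (_ : Lattice M) (_ : BoundedOrder M) (complM : M → M),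
      (∀ x : M, complM (complM x) = x) ∧
      (∀ x y : M, x ≤ y → complM y ≤ complM x) ∧
      (∀ x : M, x ⊓ complM x = ⊥) ∧
      (∀ x : M, x ⊔ complM x = ⊤) ∧
      (∀ x y : M, x ≤ y → y = x ⊔ (y ⊓ complM x)) ∧
      ∃ h : L → M, Function.Injective h ∧
        (∀ x y : L, h (x ⊓ y) = h x ⊓ h y) ∧
        (∀ x y : L, h (x ⊔ y) = h x ⊔ h y) ∧
        (∀ x : L, h (complL x) = complM (h x)) ∧
        h ⊥ = ⊥ ∧ h ⊤ = ⊤ ∧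
        ∃ a : M, IsAtom a ∧
          (a ∉ Set.range h ∧ a < h e) ∧
          ((∀ x : L, a ≤ h x ↔ e ≤ x) ∧ (∀ m : M, h e ≤ m → m ∈ Set.range h)) ∧
          (∀ x : L, IsAtom x → x ≠ e → IsAtom (h x)) := by
  have hL : IsOrthomodular complL := ⟨hL1, hL2, hL3, hL4, hL5⟩
  obtain ⟨N, _, _, _, c, g, hc, hg⟩ := hL.exists_orderIso_type_zero
  have hge : g e ≠ ⊥ := by simpa using he
  let _ := CoatomExtension.lattice hc hge
  let _ := CoatomExtension.boundedOrder (c := c) (e := g e)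
  have hM := CoatomExtension.isOrthomodular hc hge
  have hrange : Set.range (fun x => (.base (g x) : CoatomExtension c (g e))) = Set.range .base :=
    g.surjective.range_comp _
  refine ⟨CoatomExtension c (g e), Fintype.ofFinite _, inferInstance, inferInstance, _,
    hM.compl_compl, hM.antitone, hM.inf_compl, hM.sup_compl, hM.orthomodular,
    fun x => .base (g x), CoatomExtension.base_injective.comp g.injective, ?_, ?_, ?_,
    congrArg _ g.map_bot, congrArg _ g.map_top, CoatomExtension.atom c (g e),
    CoatomExtension.isAtom_atom hc hge, ⟨?_, ?_⟩, ⟨?_, ?_⟩, ?_⟩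
  · intro x y
    beta_reduce
    rw [g.map_inf, CoatomExtension.base_inf hc hge]
  · intro x y
    beta_reduce
    rw [g.map_sup, CoatomExtension.base_sup hc hge]
  · intro x
    beta_reduce
    rw [hg]
    rfl
  · rw [hrange]
    exact CoatomExtension.atom_notMem_range_base
  · exact lt_of_le_of_ne (CoatomExtension.atom_le_base_iff.2 le_rfl) nofun
  · intro x
    exact CoatomExtension.atom_le_base_iff.trans g.le_iff_le
  · intro m hm
    rw [hrange]
    exact CoatomExtension.mem_range_base_of_base_le hc hge hm
  · intro x hx hxe
    exact CoatomExtension.isAtom_base hc hge ((g.isAtom_iff x).2 hx) (g.injective.ne hxe)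
end

section
/- Let V be a finite type and G a simple graph on V. Then there exist a finite orthomodular lattice L and an injective map f : V → L such that f v ≠ ⊥ for every v, and for all u, v ∈ V, G.Adj u v if and only if f u ≤ (f v)ᶜ. -/
theorem finite_graph_embeds_in_finite_OML
    (V : Type*) [Finite V] (G : SimpleGraph V) :
    ∃ (L : Type) (_ : Fintype L) (_ : Lattice L) (_ : BoundedOrder L) (compl : L → L),
      (∀ x : L, compl (compl x) = x) ∧
      (∀ x y : L, x ≤ y → compl y ≤ compl x) ∧
      (∀ x : L, x ⊓ compl x = ⊥) ∧
      (∀ x : L, x ⊔ compl x = ⊤) ∧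
      (∀ x y : L, x ≤ y → y = x ⊔ (y ⊓ compl x)) ∧
      ∃ f : V → L, Function.Injective f ∧ (∀ v : V, f v ≠ ⊥) ∧
        (∀ u v : V, G.Adj u v ↔ f u ≤ compl (f v)) := by
  classical
  -- A Boolean algebra suffices: send `v` to the set of non-adjacent pairs containing `v`.
  obtain ⟨n, ⟨e⟩⟩ := Finite.exists_equiv_fin V
  let f : V → Set (Fin n × Fin n) := fun v =>
    {p | ¬ G.Adj (e.symm p.1) (e.symm p.2) ∧ (e.symm p.1 = v ∨ e.symm p.2 = v)}
  have mem_f (a b v : V) : (e a, e b) ∈ f v ↔ ¬ G.Adj a b ∧ (a = v ∨ b = v) := by simp [f]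
  refine ⟨Set (Fin n × Fin n), inferInstance, inferInstance, inferInstance, (·ᶜ),
    compl_compl, fun _ _ h => compl_le_compl h, fun _ => inf_compl_eq_bot,
    fun _ => sup_compl_eq_top, fun x y h => ?_, f, fun u v h => ?_, fun v h => ?_,
    fun u v => ⟨?_, fun h => ?_⟩⟩
  · rw [sup_inf_left, sup_compl_eq_top, inf_top_eq, sup_eq_right.mpr h]
  · have hu : (e u, e u) ∈ f u := (mem_f u u u).mpr ⟨G.irrefl, Or.inl rfl⟩
    rw [h, mem_f] at hu
    exact hu.2.elim id id
  · have hv : (e v, e v) ∈ f v := (mem_f v v v).mpr ⟨G.irrefl, Or.inl rfl⟩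
    rw [h] at hv
    exact hv
  · rintro huv p ⟨hp, hpu⟩ ⟨-, hpv⟩
    rcases hpu with rfl | rfl <;> rcases hpv with h | h
    · exact huv.ne h
    · exact hp (h ▸ huv)
    · exact hp (h ▸ huv.symm)
    · exact huv.ne h
  · by_contra huv
    exact h ((mem_f u v u).mpr ⟨huv, Or.inl rfl⟩) ((mem_f u v v).mpr ⟨huv, Or.inr rfl⟩)
end
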